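/- arXiv:2004.01910 — 13 statements merged into one kernel-verified Lean document; each statement's English description precedes it below -/
import Mathlib

section
/- For all x, y with 0 ≤ x < y ≤ 1, it holds that G(x) < G(y); that is, the function G is strictly increasing on [0,1]. -/
/-- Let `f : ℝ → ℝ` be continuous and strictly increasing on `[0,1]` with `f 0 = 0`, and let
`G x = x * f x + ∫ θ in x..1, f θ`.  Then `G` is strictly increasing on `[0,1]`:
for all `x, y` with `0 ≤ x < y ≤ 1` we have `G x < G y`. -/
theorem G_strictMono
    (f : ℝ → ℝ)
    (hf_cont : ContinuousOn f (Set.Icc 0 1))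
    (hf_mono : StrictMonoOn f (Set.Icc 0 1))
    (hf0 : f 0 = 0)
    (G : ℝ → ℝ)
    (hG : ∀ x, G x = x * f x + ∫ θ in x..1, f θ) :
    ∀ x y : ℝ, 0 ≤ x → x < y → y ≤ 1 → G x < G y := by
  intro x y hx hxy hy
  have hc : ContinuousOn f (Set.Icc x y) :=
    hf_cont.mono (Set.Icc_subset_Icc hx hy)
  have h1 : IntervalIntegrable f MeasureTheory.volume x y :=
    ContinuousOn.intervalIntegrable_of_Icc hxy.le hc
  have h2 : IntervalIntegrable f MeasureTheory.volume y 1 :=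
    ContinuousOn.intervalIntegrable_of_Icc hy
      (hf_cont.mono (Set.Icc_subset_Icc (hx.trans hxy.le) le_rfl))
  have hadd := intervalIntegral.integral_add_adjacent_intervals h1 h2
  have hxm : x ∈ Set.Icc (0 : ℝ) 1 := ⟨hx, by linarith⟩
  have hym : y ∈ Set.Icc (0 : ℝ) 1 := ⟨by linarith, hy⟩
  have hlt : f x < f y := hf_mono hxm hym hxy
  have hint : ∫ θ in x..y, f θ < ∫ _ in x..y, f y := by
    apply intervalIntegral.integral_lt_integral_of_continuousOn_of_le_of_exists_lt hxy hc
      continuousOn_const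
    · intro t ht
      exact hf_mono.monotoneOn ⟨by linarith [ht.1], by linarith [ht.2]⟩ hym ht.2
    · exact ⟨x, ⟨le_rfl, hxy.le⟩, hlt⟩
  rw [intervalIntegral.integral_const, smul_eq_mul] at hint
  rw [hG x, hG y, ← hadd]
  nlinarith [mul_nonneg hx (sub_nonneg.2 hlt.le)]
end

section
/- There exists a unique β ∈ [0,1] with f(β) = δ·G(β); moreover this β satisfies β > 0, and if δ < 1 then β < 1. -/
/-- Let `f` be continuous and strictly increasing on `[0,1]` with `f 0 = 0`, let `δ ∈ (0,1]`,
and let `G x = x * f x + ∫ θ in x..1, f θ`.  There exists a unique `β ∈ [0,1]` with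
`f β = δ * G β`; moreover this `β` satisfies `β > 0`, and if `δ < 1` then `β < 1`. -/
theorem fixed_point_exists_unique
    (f : ℝ → ℝ)
    (hf_cont : ContinuousOn f (Set.Icc 0 1))
    (hf_mono : StrictMonoOn f (Set.Icc 0 1))
    (hf0 : f 0 = 0)
    (δ : ℝ) (hδ : δ ∈ Set.Ioc (0 : ℝ) 1)
    (G : ℝ → ℝ)
    (hG : ∀ x, G x = x * f x + ∫ θ in x..1, f θ) :
    (∃! β : ℝ, β ∈ Set.Icc (0 : ℝ) 1 ∧ f β = δ * G β) ∧
    (∀ β : ℝ, β ∈ Set.Icc (0 : ℝ) 1 → f β = δ * G β →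
      0 < β ∧ (δ < 1 → β < 1)) := by
  obtain ⟨hδ0, hδ1⟩ := hδ
  have hint : ∀ x ∈ Set.Icc (0:ℝ) 1, ∀ y ∈ Set.Icc (0:ℝ) 1,
      IntervalIntegrable f MeasureTheory.volume x y := by
    intro x hx y hy
    apply ContinuousOn.intervalIntegrable
    exact hf_cont.mono (Set.OrdConnected.uIcc_subset Set.ordConnected_Icc hx hy)
  have h0 : (0:ℝ) ∈ Set.Icc (0:ℝ) 1 := by simp
  have h1 : (1:ℝ) ∈ Set.Icc (0:ℝ) 1 := by simp
  have key : ∀ x ∈ Set.Icc (0:ℝ) 1, ∀ y ∈ Set.Icc (0:ℝ) 1, x < y →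
      (y - x) * f x < ∫ θ in x..y, f θ := by
    intro x hx y hy hxy
    have h := intervalIntegral.integral_lt_integral_of_continuousOn_of_le_of_exists_lt
      (f := fun _ => f x) (g := f) hxy continuousOn_const
      (hf_cont.mono (Set.Icc_subset_Icc hx.1 hy.2))
      (fun t ht => hf_mono.monotoneOn hx ⟨hx.1.trans ht.1.le, ht.2.trans hy.2⟩ ht.1.le)
      ⟨y, ⟨hxy.le, le_rfl⟩, hf_mono hx hy hxy⟩
    simpa using h
  have hH : ∀ x ∈ Set.Icc (0:ℝ) 1, ∀ y ∈ Set.Icc (0:ℝ) 1, x < y →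
      f x - δ * G x < f y - δ * G y := by
    intro x hx y hy hxy
    have hk := key x hx y hy hxy
    have hadd := intervalIntegral.integral_add_adjacent_intervals (hint x hx y hy) (hint y hy 1 h1)
    have hf := hf_mono hx hy hxy
    have hd : G y - G x < y * (f y - f x) := by
      rw [hG, hG]; linarith
    have h2 := mul_lt_mul_of_pos_left hd hδ0
    have h3 : δ * y ≤ 1 := mul_le_one₀ hδ1 hy.1 hy.2
    have h4 := mul_nonneg (sub_nonneg.2 h3) (sub_pos.2 hf).le
    nlinarith
  have hG0 : 0 < G 0 := by
    have := key 0 h0 1 h1 one_pos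
    rw [hf0] at this
    rw [hG]; linarith
  have hG1 : G 1 = f 1 := by rw [hG]; simp
  have hf1 : 0 < f 1 := by rw [← hf0]; exact hf_mono h0 h1 one_pos
  have hcG : ContinuousOn G (Set.Icc 0 1) := by
    have hc := intervalIntegral.continuousOn_primitive_interval_left (f := f) (a := 0) (b := 1)
      (μ := MeasureTheory.volume) (by
        rw [Set.uIcc_of_le zero_le_one]; exact hf_cont.integrableOn_Icc)
    rw [Set.uIcc_of_le zero_le_one] at hc
    have : G = fun x => x * f x + ∫ θ in x..1, f θ := funext hG
    rw [this]
    exact (continuousOn_id.mul hf_cont).add hc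
  have hcH : ContinuousOn (fun x => f x - δ * G x) (Set.Icc 0 1) :=
    hf_cont.sub (continuousOn_const.mul hcG)
  refine ⟨?_, ?_⟩
  · obtain ⟨β, hβ, hβ0⟩ := intermediate_value_Icc zero_le_one hcH
      (show (0:ℝ) ∈ Set.Icc (f 0 - δ * G 0) (f 1 - δ * G 1) by
        constructor
        · rw [hf0]; nlinarith
        · rw [hG1]; nlinarith)
    have hβ0' : f β - δ * G β = 0 := hβ0
    refine ⟨β, ⟨hβ, by linarith⟩, ?_⟩
    rintro γ ⟨hγ, hγ0⟩
    rcases lt_trichotomy γ β with h | h | h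
    · have := hH _ hγ _ hβ h
      linarith
    · exact h
    · have := hH _ hβ _ hγ h
      linarith
  · intro β hβ he
    refine ⟨lt_of_le_of_ne hβ.1 ?_, fun hlt => lt_of_le_of_ne hβ.2 ?_⟩
    · rintro rfl
      rw [hf0] at he
      nlinarith [mul_pos hδ0 hG0]
    · rintro rfl
      rw [hG1] at he
      nlinarith
end

section
/- The function x ↦ δ·G(x) − f(x) is strictly decreasing on [0,1]: for all x, y with 0 ≤ x < y ≤ 1, δ·G(y) − f(y) < δ·G(x) − f(x). -/
/-- Let `f` be continuous and strictly increasing on `[0,1]` with `f 0 = 0`, let `δ ∈ (0,1]`,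
and let `G x = x * f x + ∫ θ in x..1, f θ`.  Then `x ↦ δ * G x - f x` is strictly
decreasing on `[0,1]`: for all `0 ≤ x < y ≤ 1`, `δ * G y - f y < δ * G x - f x`. -/
theorem discounted_G_sub_f_strictAnti
    (f : ℝ → ℝ)
    (hf_cont : ContinuousOn f (Set.Icc 0 1))
    (hf_mono : StrictMonoOn f (Set.Icc 0 1))
    (hf0 : f 0 = 0)
    (δ : ℝ) (hδ : δ ∈ Set.Ioc (0 : ℝ) 1)
    (G : ℝ → ℝ)
    (hG : ∀ x, G x = x * f x + ∫ θ in x..1, f θ) :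
    ∀ x y : ℝ, 0 ≤ x → x < y → y ≤ 1 → δ * G y - f y < δ * G x - f x := by
  intro x y hx hxy hy
  have hsub : Set.Icc x y ⊆ Set.Icc (0 : ℝ) 1 := Set.Icc_subset_Icc hx hy
  have hxm : x ∈ Set.Icc (0 : ℝ) 1 := ⟨hx, by linarith⟩
  have hym : y ∈ Set.Icc (0 : ℝ) 1 := ⟨by linarith, hy⟩
  have hF : f x < f y := hf_mono hxm hym hxy
  have hi1 : IntervalIntegrable f MeasureTheory.volume x y := by
    apply ContinuousOn.intervalIntegrable
    rw [Set.uIcc_of_le hxy.le]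
    exact hf_cont.mono hsub
  have hi2 : IntervalIntegrable f MeasureTheory.volume y 1 := by
    apply ContinuousOn.intervalIntegrable
    rw [Set.uIcc_of_le hy]
    exact hf_cont.mono (Set.Icc_subset_Icc hym.1 le_rfl)
  have hadd := intervalIntegral.integral_add_adjacent_intervals hi1 hi2
  have hlt : ∫ _θ in x..y, f x < ∫ θ in x..y, f θ := by
    apply intervalIntegral.integral_lt_integral_of_continuousOn_of_le_of_exists_lt hxy
      continuousOn_const (hf_cont.mono hsub)
    · intro t ht
      exact hf_mono.monotoneOn hxm (hsub ⟨ht.1.le, ht.2⟩) ht.1.le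
    · exact ⟨y, ⟨hxy.le, le_rfl⟩, hF⟩
  rw [intervalIntegral.integral_const, smul_eq_mul] at hlt
  have hD : G y - G x < f y - f x := by
    rw [hG, hG, ← hadd]
    nlinarith [mul_nonneg (sub_nonneg.2 hy) (sub_nonneg.2 hF.le)]
  have h1 := mul_lt_mul_of_pos_left hD hδ.1
  have h2 := mul_le_mul_of_nonneg_right hδ.2 (sub_nonneg.2 hF.le)
  linarith
end

section
/- Suppose β ∈ [0,1] satisfies f(β) = δ·G(β). Then for every y ∈ [0,1]: if y < β then f(y) < δ·G(y), and if y > β then f(y) > δ·G(y). -/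
/-- Let `f` be continuous and strictly increasing on `[0,1]` with `f 0 = 0`, let `δ ∈ (0,1]`,
and let `G x = x * f x + ∫ θ in x..1, f θ`.  Suppose `β ∈ [0,1]` satisfies `f β = δ * G β`.
Then for every `y ∈ [0,1]`: if `y < β` then `f y < δ * G y`, and if `y > β` then
`f y > δ * G y`. -/
theorem below_above_fixed_point
    (f : ℝ → ℝ)
    (hf_cont : ContinuousOn f (Set.Icc 0 1))
    (hf_mono : StrictMonoOn f (Set.Icc 0 1))
    (hf0 : f 0 = 0)
    (δ : ℝ) (hδ : δ ∈ Set.Ioc (0 : ℝ) 1)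
    (G : ℝ → ℝ)
    (hG : ∀ x, G x = x * f x + ∫ θ in x..1, f θ)
    (β : ℝ) (hβ : β ∈ Set.Icc (0 : ℝ) 1) (hfix : f β = δ * G β) :
    ∀ y ∈ Set.Icc (0 : ℝ) 1,
      (y < β → f y < δ * G y) ∧ (y > β → f y > δ * G y) := by
  have key : ∀ x z : ℝ, 0 ≤ x → x < z → z ≤ 1 → f x - δ * G x < f z - δ * G z := by
    intro x z hx hxz hz
    have hint : ∀ a b : ℝ, 0 ≤ a → a ≤ b → b ≤ 1 →
        IntervalIntegrable f MeasureTheory.volume a b := by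
      intro a b ha hab hb
      apply ContinuousOn.intervalIntegrable
      rw [Set.uIcc_of_le hab]
      exact hf_cont.mono (Set.Icc_subset_Icc ha hb)
    have hadd := intervalIntegral.integral_add_adjacent_intervals
      (hint x z hx hxz.le hz) (hint z 1 (hx.trans hxz.le) hz le_rfl)
    have hxm : x ∈ Set.Icc (0 : ℝ) 1 := ⟨hx, by linarith⟩
    have hzm : z ∈ Set.Icc (0 : ℝ) 1 := ⟨by linarith, hz⟩
    have hlt : (∫ _ in x..z, f x) < ∫ θ in x..z, f θ := by
      apply intervalIntegral.integral_lt_integral_of_continuousOn_of_le_of_exists_lt hxz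
        continuousOn_const (hf_cont.mono (Set.Icc_subset_Icc hx hz))
      · intro t ht
        exact hf_mono.monotoneOn hxm ⟨by linarith [ht.1], by linarith [ht.2]⟩ ht.1.le
      · exact ⟨z, ⟨hxz.le, le_rfl⟩, hf_mono hxm hzm hxz⟩
    rw [intervalIntegral.integral_const, smul_eq_mul] at hlt
    have hfz := hf_mono hxm hzm hxz
    have h1 : G z - G x < z * (f z - f x) := by
      rw [hG, hG]; linarith
    have h2 : δ * (G z - G x) < δ * (z * (f z - f x)) := mul_lt_mul_of_pos_left h1 hδ.1
    have h3 : δ * z ≤ 1 := mul_le_one₀ hδ.2 hzm.1 hz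
    have h4 : δ * z * (f z - f x) ≤ 1 * (f z - f x) :=
      mul_le_mul_of_nonneg_right h3 (by linarith)
    linarith
  intro y hy
  refine ⟨fun h => ?_, fun h => ?_⟩
  · linarith [key y β hy.1 h hβ.2]
  · linarith [key β y hβ.1 h hy.2]
end

section
/- The fixed point β tends to 1 as δ tends to 1: for every ε > 0 there exists δ₀ ∈ (0,1) such that for every δ ∈ [δ₀,1] and every β ∈ [0,1] with f(β) = δ·G(β), one has β > 1 − ε. -/
/-- Let `f` be continuous and strictly increasing on `[0,1]` with `f 0 = 0`, and let
`G x = x * f x + ∫ θ in x..1, f θ`.  The fixed point `β` tends to `1` as `δ` tends to `1`: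
for every `ε > 0` there exists `δ₀ ∈ (0,1)` such that for every `δ ∈ [δ₀,1]` and every
`β ∈ [0,1]` with `f β = δ * G β`, one has `β > 1 - ε`. -/
theorem fixed_point_tendsto_one
    (f : ℝ → ℝ)
    (hf_cont : ContinuousOn f (Set.Icc 0 1))
    (hf_mono : StrictMonoOn f (Set.Icc 0 1))
    (hf0 : f 0 = 0)
    (G : ℝ → ℝ)
    (hG : ∀ x, G x = x * f x + ∫ θ in x..1, f θ) :
    ∀ ε > (0 : ℝ), ∃ δ₀ ∈ Set.Ioo (0 : ℝ) 1,
      ∀ δ ∈ Set.Icc δ₀ 1, ∀ β ∈ Set.Icc (0 : ℝ) 1,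
        f β = δ * G β → β > 1 - ε := by
  have key : ∀ a b : ℝ, 0 ≤ a → a ≤ b → b ≤ 1 →
      IntervalIntegrable f MeasureTheory.volume a b ∧
      (b - a) * f a ≤ ∫ θ in a..b, f θ ∧ (∫ θ in a..b, f θ) ≤ (b - a) * f b := by
    intro a b ha hab hb
    have hint : IntervalIntegrable f MeasureTheory.volume a b := by
      apply ContinuousOn.intervalIntegrable
      rw [Set.uIcc_of_le hab]
      exact hf_cont.mono (Set.Icc_subset_Icc ha hb)
    refine ⟨hint, ?_, ?_⟩
    · have h := intervalIntegral.integral_mono_on (μ := MeasureTheory.volume) hab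
        (intervalIntegrable_const (c := f a)) hint
        (fun x hx => hf_mono.monotoneOn ⟨ha, hab.trans hb⟩
          ⟨ha.trans hx.1, hx.2.trans hb⟩ hx.1)
      simpa using h
    · have h := intervalIntegral.integral_mono_on (μ := MeasureTheory.volume) hab
        hint (intervalIntegrable_const (c := f b))
        (fun x hx => hf_mono.monotoneOn ⟨ha.trans hx.1, hx.2.trans hb⟩
          ⟨ha.trans hab, hb⟩ hx.2)
      simpa using h
  intro ε hε
  by_cases hc : 1 - ε < 0
  · exact ⟨1 / 2, by norm_num, fun δ _ β hβ _ => lt_of_lt_of_le hc hβ.1⟩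
  push Not at hc
  obtain ⟨c, hcdef⟩ : ∃ c, c = 1 - ε := ⟨_, rfl⟩
  obtain ⟨m, hm⟩ : ∃ m, m = (c + 1) / 2 := ⟨_, rfl⟩
  have hc0 : 0 ≤ c := by linarith
  have hcm : c < m := by linarith
  have hm1 : m < 1 := by linarith
  have hfc : 0 ≤ f c := by
    have := hf_mono.monotoneOn (a := 0) (b := c) ⟨le_rfl, by norm_num⟩ ⟨hc0, by linarith⟩ hc0
    linarith
  have hfcm : f c < f m := hf_mono ⟨hc0, by linarith⟩ ⟨by linarith, hm1.le⟩ hcm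
  have hfm1 : f m < f 1 := hf_mono ⟨by linarith, hm1.le⟩ ⟨by norm_num, le_rfl⟩ hm1
  have hf1 : 0 < f 1 := by linarith
  obtain ⟨h, hh⟩ : ∃ h, h = (1 - m) * (f m - f c) := ⟨_, rfl⟩
  have hpos : 0 < h := by rw [hh]; exact mul_pos (by linarith) (by linarith)
  have hlt : h < f 1 := by rw [hh]; nlinarith
  have hq : 0 < h / (2 * f 1) := by positivity
  have hq1 : h / (2 * f 1) < 1 := by rw [div_lt_one (by positivity)]; linarith
  have hqe : h / (2 * f 1) * f 1 = h / 2 := by field_simp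
  refine ⟨1 - h / (2 * f 1), ⟨by linarith, by linarith⟩, ?_⟩
  intro δ hδ β hβ hfix
  by_contra hcon
  have hβc : β ≤ c := by linarith
  obtain ⟨i1, l1, -⟩ := key β m hβ.1 (by linarith) hm1.le
  obtain ⟨i2, l2, -⟩ := key m 1 (by linarith) hm1.le le_rfl
  obtain ⟨-, -, u⟩ := key β 1 hβ.1 hβ.2 le_rfl
  have hadd := intervalIntegral.integral_add_adjacent_intervals i1 i2
  have hfβc : f β ≤ f c := hf_mono.monotoneOn hβ ⟨hc0, by linarith⟩ hβc
  have hg := hG β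
  have hG1 : G β ≤ f 1 := by
    have : β * f β ≤ β * f 1 := mul_le_mul_of_nonneg_left (by linarith) hβ.1
    linarith
  have hGl : f β + h ≤ G β := by
    have : (1 - m) * (f m - f c) ≤ (1 - m) * (f m - f β) :=
      mul_le_mul_of_nonneg_left (by linarith) (by linarith)
    linarith
  have e1 : (1 - δ) * G β ≤ (1 - δ) * f 1 :=
    mul_le_mul_of_nonneg_left hG1 (by linarith [hδ.2])
  have e2 : (1 - δ) * f 1 ≤ h / (2 * f 1) * f 1 :=
    mul_le_mul_of_nonneg_right (by linarith [hδ.1]) hf1.le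
  linarith
end

section
/- Let T ≥ 2 be a natural number and let b : {1,…,T} → [0,1] satisfy b(T) = 0 and f(b(t)) = δ·G(b(t+1)) for all t ∈ {1,…,T−1} (the backward-induction thresholds of the finite-horizon game). Then 0 = b(T) < b(T−1) < ⋯ < b(1) < β ≤ 1, where β ∈ [0,1] is the unique solution of f(β) = δ·G(β). -/
/-- Let `f` be continuous and strictly increasing on `[0,1]` with `f 0 = 0`, let `δ ∈ (0,1]`,
and let `G x = x * f x + ∫ θ in x..1, f θ`.  Let `T ≥ 2` and let `b` (defined on
`{1,…,T}`, taking values in `[0,1]`) satisfy `b T = 0` and `f (b t) = δ * G (b (t+1))`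
for all `t ∈ {1,…,T-1}` (the backward-induction thresholds of the finite-horizon game).
Then `0 = b T < b (T-1) < ⋯ < b 1 < β ≤ 1`, where `β ∈ [0,1]` is the unique solution of
`f β = δ * G β`. -/
theorem finite_horizon_thresholds_increasing
    (f : ℝ → ℝ)
    (hf_cont : ContinuousOn f (Set.Icc 0 1))
    (hf_mono : StrictMonoOn f (Set.Icc 0 1))
    (hf0 : f 0 = 0)
    (δ : ℝ) (hδ : δ ∈ Set.Ioc (0 : ℝ) 1)
    (G : ℝ → ℝ)
    (hG : ∀ x, G x = x * f x + ∫ θ in x..1, f θ)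
    (T : ℕ) (hT : 2 ≤ T)
    (b : ℕ → ℝ)
    (hb_mem : ∀ t, 1 ≤ t → t ≤ T → b t ∈ Set.Icc (0 : ℝ) 1)
    (hbT : b T = 0)
    (hrec : ∀ t, 1 ≤ t → t < T → f (b t) = δ * G (b (t + 1)))
    (β : ℝ) (hβ : β ∈ Set.Icc (0 : ℝ) 1) (hfix : f β = δ * G β) :
    (∀ t, 1 ≤ t → t < T → b (t + 1) < b t) ∧ b 1 < β ∧ β ≤ 1 := by
  have key : ∀ x ∈ Set.Icc (0:ℝ) 1, ∀ y ∈ Set.Icc (0:ℝ) 1, x < y →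
      (y - x) * f x < (∫ θ in x..y, f θ) ∧ (∫ θ in x..y, f θ) < (y - x) * f y := by
    intro x hx y hy hxy
    have hsub : Set.Icc x y ⊆ Set.Icc 0 1 := Set.Icc_subset_Icc hx.1 hy.2
    have hc := hf_cont.mono hsub
    have h1 : (∫ θ in x..y, f x) < ∫ θ in x..y, f θ := by
      apply intervalIntegral.integral_lt_integral_of_continuousOn_of_le_of_exists_lt hxy
        continuousOn_const hc
      · intro z hz
        exact hf_mono.monotoneOn hx (hsub ⟨hz.1.le, hz.2⟩) hz.1.le
      · exact ⟨y, ⟨hxy.le, le_rfl⟩, hf_mono hx hy hxy⟩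
    have h2 : (∫ θ in x..y, f θ) < ∫ θ in x..y, f y := by
      apply intervalIntegral.integral_lt_integral_of_continuousOn_of_le_of_exists_lt hxy
        hc continuousOn_const
      · intro z hz
        exact hf_mono.monotoneOn (hsub ⟨hz.1.le, hz.2⟩) hy hz.2
      · exact ⟨x, ⟨le_rfl, hxy.le⟩, hf_mono hx hy hxy⟩
    simp only [intervalIntegral.integral_const, smul_eq_mul] at h1 h2
    exact ⟨h1, h2⟩
  have hint : ∀ x ∈ Set.Icc (0:ℝ) 1, ∀ y ∈ Set.Icc (0:ℝ) 1, x ≤ y →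
      IntervalIntegrable f MeasureTheory.volume x y := by
    intro x hx y hy hxy
    apply ContinuousOn.intervalIntegrable
    rw [Set.uIcc_of_le hxy]
    exact hf_cont.mono (Set.Icc_subset_Icc hx.1 hy.2)
  have m0 : (0:ℝ) ∈ Set.Icc (0:ℝ) 1 := by simp
  have m1 : (1:ℝ) ∈ Set.Icc (0:ℝ) 1 := by simp
  have hGm : ∀ x ∈ Set.Icc (0:ℝ) 1, ∀ y ∈ Set.Icc (0:ℝ) 1, x < y → δ * G x < δ * G y := by
    intro x hx y hy hxy
    apply mul_lt_mul_of_pos_left _ hδ.1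
    rw [hG, hG, ← intervalIntegral.integral_add_adjacent_intervals (hint x hx y hy hxy.le)
      (hint y hy 1 m1 hy.2)]
    have h := (key x hx y hy hxy).2
    have h3 := mul_nonneg hx.1 (sub_nonneg.2 (hf_mono hx hy hxy).le)
    linarith
  have hG0 : 0 < δ * G 0 := by
    apply mul_pos hδ.1
    have h := (key 0 m0 1 m1 one_pos).1
    rw [hf0] at h
    rw [hG]
    linarith
  have hβ0 : 0 < β := by
    rcases hβ.1.lt_or_eq with h | h
    · exact h
    · rw [← h, hf0] at hfix
      linarith
  have main : ∀ k t, 1 ≤ t → t + k + 1 = T → b (t + 1) < b t ∧ b t < β := by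
    intro k
    induction k with
    | zero =>
      intro t ht hk
      have hr := hrec t ht (by omega)
      have hm := hb_mem t ht (by omega)
      have e : b (t + 1) = 0 := by
        rw [show t + 1 = T by omega, hbT]
      rw [e] at hr ⊢
      constructor
      · rw [← hf_mono.lt_iff_lt m0 hm, hr, hf0]
        exact hG0
      · rw [← hf_mono.lt_iff_lt hm hβ, hr, hfix]
        exact hGm 0 m0 β hβ hβ0
    | succ k ih =>
      intro t ht hk
      obtain ⟨i1, i2⟩ := ih (t + 1) (by omega) (by omega)
      have hr := hrec t ht (by omega)
      have hr' := hrec (t + 1) (by omega) (by omega)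
      have hm := hb_mem t ht (by omega)
      have hm1 := hb_mem (t + 1) (by omega) (by omega)
      have hm2 := hb_mem (t + 1 + 1) (by omega) (by omega)
      constructor
      · rw [← hf_mono.lt_iff_lt hm1 hm, hr, hr']
        exact hGm _ hm2 _ hm1 i1
      · rw [← hf_mono.lt_iff_lt hm hβ, hr, hfix]
        exact hGm _ hm1 _ hβ i2
  exact ⟨fun t h1 h2 => (main (T - t - 1) t h1 (by omega)).1,
    (main (T - 2) 1 le_rfl (by omega)).2, hβ.2⟩
end

section
/- Let a : ℕ → [0,1] satisfy a(0) = 0 and f(a(n+1)) = δ·G(a(n)) for all n ∈ ℕ. Then the sequence a is strictly increasing, a(n) < β for all n (where β is the unique solution in [0,1] of f(β) = δ·G(β)), and a(n) converges to β as n → ∞. -/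
/-- Let `f` be continuous and strictly increasing on `[0,1]` with `f 0 = 0`, let `δ ∈ (0,1]`,
and let `G x = x * f x + ∫ θ in x..1, f θ`.  Let `a : ℕ → [0,1]` satisfy `a 0 = 0` and
`f (a (n+1)) = δ * G (a n)` for all `n`.  Then `a` is strictly increasing, `a n < β` for
all `n` (where `β` is the unique solution in `[0,1]` of `f β = δ * G β`), and
`a n → β` as `n → ∞`. -/
theorem first_period_thresholds_converge
    (f : ℝ → ℝ)
    (hf_cont : ContinuousOn f (Set.Icc 0 1))
    (hf_mono : StrictMonoOn f (Set.Icc 0 1))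
    (hf0 : f 0 = 0)
    (δ : ℝ) (hδ : δ ∈ Set.Ioc (0 : ℝ) 1)
    (G : ℝ → ℝ)
    (hG : ∀ x, G x = x * f x + ∫ θ in x..1, f θ)
    (a : ℕ → ℝ)
    (ha_mem : ∀ n, a n ∈ Set.Icc (0 : ℝ) 1)
    (ha0 : a 0 = 0)
    (hrec : ∀ n, f (a (n + 1)) = δ * G (a n))
    (β : ℝ) (hβ : β ∈ Set.Icc (0 : ℝ) 1) (hfix : f β = δ * G β) :
    StrictMono a ∧ (∀ n, a n < β) ∧
      Filter.Tendsto a Filter.atTop (nhds β) := by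
  have hint : ∀ x y, x ∈ Set.Icc (0:ℝ) 1 → y ∈ Set.Icc (0:ℝ) 1 →
      IntervalIntegrable f MeasureTheory.volume x y := by
    intro x y hx hy
    apply ContinuousOn.intervalIntegrable
    exact hf_cont.mono (Set.uIcc_subset_Icc hx hy)
  have hlow : ∀ x y, x ∈ Set.Icc (0:ℝ) 1 → y ∈ Set.Icc (0:ℝ) 1 → x < y →
      (y - x) * f x < ∫ θ in x..y, f θ := by
    intro x y hx hy hxy
    have hsub : Set.Icc x y ⊆ Set.Icc 0 1 := Set.Icc_subset_Icc hx.1 hy.2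
    have h := intervalIntegral.integral_lt_integral_of_continuousOn_of_le_of_exists_lt
      (f := fun _ => f x) (g := f) hxy continuousOn_const (hf_cont.mono hsub)
      (fun t ht => hf_mono.monotoneOn hx (hsub (Set.Ioc_subset_Icc_self ht)) ht.1.le)
      ⟨y, ⟨hxy.le, le_rfl⟩, hf_mono hx hy hxy⟩
    simpa using h
  have hup : ∀ x y, x ∈ Set.Icc (0:ℝ) 1 → y ∈ Set.Icc (0:ℝ) 1 → x < y →
      ∫ θ in x..y, f θ < (y - x) * f y := by
    intro x y hx hy hxy
    have hsub : Set.Icc x y ⊆ Set.Icc 0 1 := Set.Icc_subset_Icc hx.1 hy.2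
    have h := intervalIntegral.integral_lt_integral_of_continuousOn_of_le_of_exists_lt
      (f := f) (g := fun _ => f y) hxy (hf_cont.mono hsub) continuousOn_const
      (fun t ht => hf_mono.monotoneOn (hsub (Set.Ioc_subset_Icc_self ht)) hy ht.2)
      ⟨x, ⟨le_rfl, hxy.le⟩, hf_mono hx hy hxy⟩
    simpa using h
  have h0m : (0:ℝ) ∈ Set.Icc (0:ℝ) 1 := by simp
  have h1m : (1:ℝ) ∈ Set.Icc (0:ℝ) 1 := by simp
  have hGd : ∀ x y, x ∈ Set.Icc (0:ℝ) 1 → y ∈ Set.Icc (0:ℝ) 1 → x < y →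
      0 < G y - G x ∧ G y - G x < f y - f x := by
    intro x y hx hy hxy
    have h1 := hlow x y hx hy hxy
    have h2 := hup x y hx hy hxy
    have h3 := intervalIntegral.integral_add_adjacent_intervals
      (hint x y hx hy) (hint y 1 hy h1m)
    have h4 := hf_mono hx hy hxy
    rw [hG, hG, ← h3]
    have h5 : 0 ≤ x * (f y - f x) := mul_nonneg hx.1 (by linarith)
    have h6 : 0 ≤ (1 - y) * (f y - f x) := mul_nonneg (by linarith [hy.2]) (by linarith)
    constructor <;> nlinarith
  have hH : ∀ x y, x ∈ Set.Icc (0:ℝ) 1 → y ∈ Set.Icc (0:ℝ) 1 → x < y →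
      f x - δ * G x < f y - δ * G y := by
    intro x y hx hy hxy
    obtain ⟨h1, h2⟩ := hGd x y hx hy hxy
    have h3 : 0 ≤ (1 - δ) * (G y - G x) := mul_nonneg (by linarith [hδ.2]) h1.le
    nlinarith
  have hG0 : 0 < G 0 := by
    have := hlow 0 1 h0m h1m one_pos
    rw [hG]
    simpa [hf0] using this
  have hβ0 : 0 < β := by
    rcases hβ.1.lt_or_eq with h | h
    · exact h
    · exfalso
      rw [← h, hf0] at hfix
      have := mul_pos hδ.1 hG0
      linarith
  have hlt : ∀ n, a n < β := by
    intro n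
    induction n with
    | zero => rw [ha0]; exact hβ0
    | succ n ih =>
      have h1 := (hGd _ _ (ha_mem n) hβ ih).1
      have h2 : f (a (n + 1)) < f β := by
        rw [hrec, hfix]
        exact mul_lt_mul_of_pos_left (by linarith) hδ.1
      exact (hf_mono.lt_iff_lt (ha_mem _) hβ).1 h2
  have hmono : StrictMono a := by
    apply strictMono_nat_of_lt_succ
    intro n
    have h := hH _ _ (ha_mem n) hβ (hlt n)
    apply (hf_mono.lt_iff_lt (ha_mem _) (ha_mem _)).1
    rw [hrec n]
    linarith
  refine ⟨hmono, hlt, ?_⟩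
  have hbdd : BddAbove (Set.range a) := ⟨1, by rintro _ ⟨n, rfl⟩; exact (ha_mem n).2⟩
  have hlim := tendsto_atTop_ciSup hmono.monotone hbdd
  have hle : ∀ n, a n ≤ ⨆ i, a i := fun n => le_ciSup hbdd n
  generalize (⨆ i, a i) = L at hlim hle
  have hL : L ∈ Set.Icc (0:ℝ) 1 :=
    isClosed_Icc.mem_of_tendsto hlim (Filter.Eventually.of_forall ha_mem)
  have hfa : Filter.Tendsto (fun n => f (a n)) Filter.atTop (nhds (f L)) :=
    (hf_cont L hL).tendsto.comp
      (tendsto_nhdsWithin_iff.2 ⟨hlim, Filter.Eventually.of_forall ha_mem⟩)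
  have hGa : Filter.Tendsto (fun n => G (a n)) Filter.atTop (nhds (G L)) := by
    have hlo : Filter.Tendsto (fun n => G L - (f L - f (a n))) Filter.atTop (nhds (G L)) := by
      have := (tendsto_const_nhds (x := G L)).sub ((tendsto_const_nhds (x := f L)).sub hfa)
      simpa using this
    refine tendsto_of_tendsto_of_tendsto_of_le_of_le hlo tendsto_const_nhds ?_ ?_
    · intro n
      rcases (hle n).lt_or_eq with h | h
      · have := (hGd _ _ (ha_mem n) hL h).2
        dsimp only
        linarith
      · simp [h]
    · intro n
      rcases (hle n).lt_or_eq with h | h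
      · have := (hGd _ _ (ha_mem n) hL h).1
        dsimp only
        linarith
      · simp [h]
  have hfL : f L = δ * G L := by
    have h1 := (Filter.tendsto_add_atTop_iff_nat 1).2 hfa
    have h2 := hGa.const_mul δ
    simp only [hrec] at h1
    exact tendsto_nhds_unique h1 h2
  have : L = β := by
    rcases lt_trichotomy L β with h | h | h
    · have := hH _ _ hL hβ h
      linarith
    · exact h
    · have := hH _ _ hβ hL h
      linarith
  exact this ▸ hlim
end

section
/- Let g : ℝ → ℝ be strictly increasing and let a ≤ b < c ≤ d be real numbers with (b,d) ≠ (a,c). Then (1/(c−a))·∫_a^c g(x) dx < (1/(d−b))·∫_b^d g(x) dx. -/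
lemma aux_bounds (g : ℝ → ℝ) (hg : StrictMono g) (u v : ℝ) (h : u ≤ v) :
    (v - u) * g u ≤ ∫ x in u..v, g x ∧ ∫ x in u..v, g x ≤ (v - u) * g v := by
  have hi : IntervalIntegrable g MeasureTheory.volume u v := hg.monotone.intervalIntegrable
  constructor
  · have := intervalIntegral.integral_mono_on h (intervalIntegrable_const (c := g u)) hi
      (fun x hx => hg.monotone hx.1)
    simpa using this
  · have := intervalIntegral.integral_mono_on h hi (intervalIntegrable_const (c := g v))
      (fun x hx => hg.monotone hx.2)
    simpa using this

/-- Let `g : ℝ → ℝ` be strictly increasing and let `a ≤ b < c ≤ d` be real numbers with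
`(b, d) ≠ (a, c)`.  Then `(1/(c-a)) * ∫ x in a..c, g x < (1/(d-b)) * ∫ x in b..d, g x`. -/
theorem average_integral_strict_mono
    (g : ℝ → ℝ) (hg : StrictMono g)
    (a b c d : ℝ) (hab : a ≤ b) (hbc : b < c) (hcd : c ≤ d)
    (hne : (b, d) ≠ (a, c)) :
    (1 / (c - a)) * ∫ x in a..c, g x < (1 / (d - b)) * ∫ x in b..d, g x := by
  have hi : ∀ u v, IntervalIntegrable g MeasureTheory.volume u v :=
    fun u v => hg.monotone.intervalIntegrable
  have e1 := intervalIntegral.integral_add_adjacent_intervals (hi a b) (hi b c)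
  have e2 := intervalIntegral.integral_add_adjacent_intervals (hi b c) (hi c d)
  obtain ⟨m, hbm, hmc⟩ := exists_between hbc
  have e3 := intervalIntegral.integral_add_adjacent_intervals (hi b m) (hi m c)
  have h1 := (aux_bounds g hg a b hab).2
  have h3 := (aux_bounds g hg c d hcd).1
  have k1 := aux_bounds g hg b m hbm.le
  have k2 := aux_bounds g hg m c hmc.le
  have gb := hg hbm
  have gc := hg hmc
  have J1 : (c - b) * g b < ∫ x in b..c, g x := by
    nlinarith [mul_pos (sub_pos.2 hmc) (sub_pos.2 gb)]
  have J2 : ∫ x in b..c, g x < (c - b) * g c := by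
    nlinarith [mul_pos (sub_pos.2 hbm) (sub_pos.2 gc)]
  rw [← e1, ← e2, one_div_mul_eq_div, one_div_mul_eq_div,
    div_lt_div_iff₀ (by linarith) (by linarith)]
  generalize (∫ x in a..b, g x) = A at *
  generalize (∫ x in b..c, g x) = J at *
  generalize (∫ x in c..d, g x) = C at *
  obtain ⟨p, rfl⟩ : ∃ p, b = a + p := ⟨b - a, by ring⟩
  obtain ⟨q, rfl⟩ : ∃ q, c = a + p + q := ⟨c - (a + p), by ring⟩
  obtain ⟨r, rfl⟩ : ∃ r, d = a + p + q + r := ⟨d - (a + p + q), by ring⟩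
  have hp : 0 ≤ p := by linarith
  have hq : 0 < q := by linarith
  have hr : 0 ≤ r := by linarith
  generalize g (a + p) = x at *
  generalize g (a + p + q) = y at *
  have h1' : A ≤ p * x := by linarith
  have h3' : r * y ≤ C := by linarith
  have J1' : q * x < J := by linarith
  have J2' : J < q * y := by linarith
  have t1 := mul_le_mul_of_nonneg_left h1' hq.le
  have t2 := mul_le_mul_of_nonneg_left h1' hr
  have t3 := mul_le_mul_of_nonneg_left h3' hq.le
  have t4 := mul_le_mul_of_nonneg_left h3' hp
  have t5 := mul_le_mul_of_nonneg_left J1'.le hp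
  have t6 := mul_le_mul_of_nonneg_left J2'.le hr
  have t7 := mul_le_mul_of_nonneg_left (show x ≤ y by linarith) (mul_nonneg hp hr)
  rcases hp.lt_or_eq with hp' | hp'
  · have t8 := mul_lt_mul_of_pos_left J1' hp'
    linarith
  rcases hr.lt_or_eq with hr' | hr'
  · have t8 := mul_lt_mul_of_pos_left J2' hr'
    linarith
  · exact absurd (by simp [← hp', ← hr']) hne
end

section
/- Suppose β ∈ [0,1] satisfies f(β) = δ·G(β). Then (1 − δ)·f(1) ≤ (f(1) − f(β))·(1 − δ·β). -/
/-- Let `f` be continuous and strictly increasing on `[0,1]` with `f 0 = 0`, let `δ ∈ (0,1]`,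
and let `G x = x * f x + ∫ θ in x..1, f θ`.  Suppose `β ∈ [0,1]` satisfies
`f β = δ * G β`.  Then `(1 - δ) * f 1 ≤ (f 1 - f β) * (1 - δ * β)`. -/
theorem fixed_point_gap_bound
    (f : ℝ → ℝ)
    (hf_cont : ContinuousOn f (Set.Icc 0 1))
    (hf_mono : StrictMonoOn f (Set.Icc 0 1))
    (hf0 : f 0 = 0)
    (δ : ℝ) (hδ : δ ∈ Set.Ioc (0 : ℝ) 1)
    (G : ℝ → ℝ)
    (hG : ∀ x, G x = x * f x + ∫ θ in x..1, f θ)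
    (β : ℝ) (hβ : β ∈ Set.Icc (0 : ℝ) 1) (hfix : f β = δ * G β) :
    (1 - δ) * f 1 ≤ (f 1 - f β) * (1 - δ * β) := by
  obtain ⟨hβ0, hβ1⟩ := hβ
  have hI : ∫ θ in β..1, f θ ≤ ∫ _θ in β..1, f 1 := by
    apply intervalIntegral.integral_mono_on hβ1
    · apply ContinuousOn.intervalIntegrable
      rw [Set.uIcc_of_le hβ1]
      exact hf_cont.mono (Set.Icc_subset_Icc_left hβ0)
    · exact intervalIntegrable_const
    · intro x hx
      exact hf_mono.monotoneOn ⟨hβ0.trans hx.1, hx.2⟩ ⟨zero_le_one, le_rfl⟩ hx.2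
  rw [intervalIntegral.integral_const, smul_eq_mul] at hI
  rw [hG] at hfix
  have h := mul_le_mul_of_nonneg_left hI hδ.1.le
  linarith
end

section
/- Assume f is Lipschitz at 1. Then for every K > 0 there exists E ∈ (0,1) such that for all δ ∈ [E,1] and all β ∈ [0,1] with f(β) = δ·G(β), one has 1 − β ≥ K·(1 − δ). -/
/-- Let `f` be continuous and strictly increasing on `[0,1]` with `f 0 = 0` and `f 1 > 0`,
and let `G x = x * f x + ∫ θ in x..1, f θ`.  Assume `f` is Lipschitz at `1`, i.e. there
exist `M > 0` and `Y ∈ (0,1)` with `f 1 - f y ≤ M * (1 - y)` for all `y ∈ [Y,1]`.  Then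
for every `K > 0` there exists `E ∈ (0,1)` such that for all `δ ∈ [E,1]` and all
`β ∈ [0,1]` with `f β = δ * G β`, one has `1 - β ≥ K * (1 - δ)`. -/
theorem one_sub_beta_lower_bound
    (f : ℝ → ℝ)
    (hf_cont : ContinuousOn f (Set.Icc 0 1))
    (hf_mono : StrictMonoOn f (Set.Icc 0 1))
    (hf0 : f 0 = 0)
    (hf1 : 0 < f 1)
    (G : ℝ → ℝ)
    (hG : ∀ x, G x = x * f x + ∫ θ in x..1, f θ)
    (hLip : ∃ M > (0 : ℝ), ∃ Y ∈ Set.Ioo (0 : ℝ) 1,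
      ∀ y ∈ Set.Icc Y 1, f 1 - f y ≤ M * (1 - y)) :
    ∀ K > (0 : ℝ), ∃ E ∈ Set.Ioo (0 : ℝ) 1,
      ∀ δ ∈ Set.Icc E 1, ∀ β ∈ Set.Icc (0 : ℝ) 1,
        f β = δ * G β → 1 - β ≥ K * (1 - δ) := by
  obtain ⟨M, hM, Y, ⟨hY0, hY1⟩, hL⟩ := hLip
  intro K hK
  have hfY : 0 < f Y := by
    rw [← hf0]
    exact hf_mono ⟨le_refl _, zero_le_one⟩ ⟨hY0.le, hY1.le⟩ hY0
  have hMK : 0 < M * K ^ 2 := by positivity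
  obtain ⟨e, he0, he1, he2, he3⟩ : ∃ e : ℝ, 0 < e ∧ e ≤ 1 / 2 ∧ e * K ≤ 1 - Y ∧
      e * (M * K ^ 2) ≤ f Y := by
    refine ⟨min (1 / 2) (min ((1 - Y) / K) (f Y / (M * K ^ 2))), ?_, min_le_left _ _, ?_, ?_⟩
    · have : 0 < 1 - Y := by linarith
      positivity
    · rw [← le_div_iff₀ hK]
      exact (min_le_right _ _).trans (min_le_left _ _)
    · rw [← le_div_iff₀ hMK]
      exact (min_le_right _ _).trans (min_le_right _ _)
  refine ⟨1 - e, ⟨by linarith, by linarith⟩, ?_⟩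
  rintro δ ⟨hδE, hδ1⟩ β ⟨hβ0, hβ1⟩ heq
  by_contra hcon
  have ht : 1 - β < K * (1 - δ) := lt_of_not_ge hcon
  have hd : 0 < 1 - δ := by
    by_contra h
    nlinarith
  have hKe : K * (1 - δ) ≤ K * e := mul_le_mul_of_nonneg_left (by linarith) hK.le
  have hYβ : Y ≤ β := by linarith
  have hβm : β ∈ Set.Icc (0 : ℝ) 1 := ⟨hβ0, hβ1⟩
  have hfβ : f Y ≤ f β := hf_mono.monotoneOn ⟨hY0.le, hY1.le⟩ hβm hYβ
  have hint : IntervalIntegrable f MeasureTheory.volume β 1 := by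
    apply ContinuousOn.intervalIntegrable_of_Icc hβ1
    exact hf_cont.mono (Set.Icc_subset_Icc_left hβ0)
  have hup : ∫ θ in β..1, f θ ≤ (1 - β) * f 1 := by
    have := intervalIntegral.integral_mono_on hβ1 hint
      (intervalIntegrable_const (c := f 1)) (fun x hx =>
        hf_mono.monotoneOn ⟨hβ0.trans hx.1, hx.2⟩ ⟨zero_le_one, le_refl _⟩ hx.2)
    simpa using this
  have hlo : (1 - β) * f β ≤ ∫ θ in β..1, f θ := by
    have := intervalIntegral.integral_mono_on hβ1
      (intervalIntegrable_const (c := f β)) hint (fun x hx =>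
        hf_mono.monotoneOn hβm ⟨hβ0.trans hx.1, hx.2⟩ hx.1)
    simpa using this
  have hGβ := hG β
  have hLβ := hL β ⟨hYβ, hβ1⟩
  have h1 : f Y ≤ G β := by nlinarith
  have h2 : (1 - δ) * G β ≤ (1 - β) * (f 1 - f β) := by nlinarith
  have h3 : (1 - β) * (f 1 - f β) ≤ (1 - β) * (M * (1 - β)) :=
    mul_le_mul_of_nonneg_left hLβ (by linarith)
  have h4 : (1 - δ) * f Y ≤ (1 - δ) * G β := mul_le_mul_of_nonneg_left h1 hd.le
  have h5 : (1 - β) ^ 2 < (K * (1 - δ)) ^ 2 := pow_lt_pow_left₀ ht (by linarith) (by norm_num)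
  have h6 : M * (1 - β) ^ 2 < M * (K * (1 - δ)) ^ 2 := mul_lt_mul_of_pos_left h5 hM
  have h7 : (1 - δ) * f Y < (1 - δ) * ((1 - δ) * (M * K ^ 2)) := by nlinarith
  have h8 : f Y < (1 - δ) * (M * K ^ 2) := lt_of_mul_lt_mul_left h7 hd.le
  have h9 : (1 - δ) * (M * K ^ 2) ≤ e * (M * K ^ 2) :=
    mul_le_mul_of_nonneg_right (by linarith) hMK.le
  linarith
end

section
/- Assume f is Lipschitz at 1. Then there exists D ∈ [0,1) such that for all δ ∈ [D,1] and all β ∈ (0,1] with f(β) = δ·G(β), one has δ·∫_0^1 g(θ) dθ ≥ (1/β)·∫_0^β g(θ) dθ (i.e., δ·V(1) ≥ V(β)). -/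
theorem aux_intble (h : ℝ → ℝ) (hc : ContinuousOn h (Set.Icc 0 1)) {a b : ℝ}
    (ha : 0 ≤ a) (hab : a ≤ b) (hb : b ≤ 1) :
    IntervalIntegrable h MeasureTheory.volume a b := by
  apply ContinuousOn.intervalIntegrable
  rw [Set.uIcc_of_le hab]
  exact hc.mono (Set.Icc_subset_Icc ha hb)

theorem aux_lower (h : ℝ → ℝ) (hc : ContinuousOn h (Set.Icc 0 1))
    (hm : StrictMonoOn h (Set.Icc 0 1)) {a b : ℝ}
    (ha : 0 ≤ a) (hab : a ≤ b) (hb : b ≤ 1) :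
    h a * (b - a) ≤ ∫ θ in a..b, h θ := by
  have := intervalIntegral.integral_mono_on hab
    (intervalIntegrable_const (c := h a)) (aux_intble h hc ha hab hb)
    (fun x hx => hm.monotoneOn ⟨ha, hab.trans hb⟩ ⟨ha.trans hx.1, hx.2.trans hb⟩ hx.1)
  rw [intervalIntegral.integral_const, smul_eq_mul] at this
  linarith

theorem aux_upper (h : ℝ → ℝ) (hc : ContinuousOn h (Set.Icc 0 1))
    (hm : StrictMonoOn h (Set.Icc 0 1)) {a b : ℝ}
    (ha : 0 ≤ a) (hab : a ≤ b) (hb : b ≤ 1) :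
    ∫ θ in a..b, h θ ≤ h b * (b - a) := by
  have := intervalIntegral.integral_mono_on hab
    (aux_intble h hc ha hab hb) (intervalIntegrable_const (c := h b))
    (fun x hx => hm.monotoneOn ⟨ha.trans hx.1, hx.2.trans hb⟩ ⟨ha.trans hab, hb⟩ hx.2)
  rw [intervalIntegral.integral_const, smul_eq_mul] at this
  linarith

theorem aux_add (h : ℝ → ℝ) (hc : ContinuousOn h (Set.Icc 0 1)) {a b c : ℝ}
    (ha : 0 ≤ a) (hab : a ≤ b) (hbc : b ≤ c) (hb : c ≤ 1) :
    (∫ θ in a..b, h θ) + (∫ θ in b..c, h θ) = ∫ θ in a..c, h θ :=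
  intervalIntegral.integral_add_adjacent_intervals
    (aux_intble h hc ha hab (hbc.trans hb)) (aux_intble h hc (ha.trans hab) hbc hb)

/-- Let `f` be continuous and strictly increasing on `[0,1]` with `f 0 = 0` and `f 1 > 0`,
and let `g` be continuous and strictly increasing on `[0,1]` with `g 0 = 0`.  Let
`G x = x * f x + ∫ θ in x..1, f θ` and `V x = (1/x) * ∫ θ in 0..x, g θ`.  Assume `f` is
Lipschitz at `1`.  Then there exists `D ∈ [0,1)` such that for all `δ ∈ [D,1]` and all
`β ∈ (0,1]` with `f β = δ * G β`, one has `δ * V 1 ≥ V β`, i.e.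
`δ * ∫ θ in 0..1, g θ ≥ (1/β) * ∫ θ in 0..β, g θ`. -/
theorem discounted_V_bound
    (f g : ℝ → ℝ)
    (hf_cont : ContinuousOn f (Set.Icc 0 1))
    (hf_mono : StrictMonoOn f (Set.Icc 0 1))
    (hf0 : f 0 = 0)
    (hf1 : 0 < f 1)
    (hg_cont : ContinuousOn g (Set.Icc 0 1))
    (hg_mono : StrictMonoOn g (Set.Icc 0 1))
    (hg0 : g 0 = 0)
    (G : ℝ → ℝ)
    (hG : ∀ x, G x = x * f x + ∫ θ in x..1, f θ)
    (hLip : ∃ M > (0 : ℝ), ∃ Y ∈ Set.Ioo (0 : ℝ) 1,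
      ∀ y ∈ Set.Icc Y 1, f 1 - f y ≤ M * (1 - y)) :
    ∃ D ∈ Set.Ico (0 : ℝ) 1,
      ∀ δ ∈ Set.Icc D 1, ∀ β ∈ Set.Ioc (0 : ℝ) 1,
        f β = δ * G β →
          δ * ∫ θ in (0 : ℝ)..1, g θ ≥ (1 / β) * ∫ θ in (0 : ℝ)..β, g θ := by
  obtain ⟨M, hM, Y, ⟨hY0, hY1⟩, hL⟩ := hLip
  have hfY : 0 < f Y := by
    have := hf_mono (a := 0) (b := Y) ⟨le_rfl, zero_le_one⟩ ⟨hY0.le, hY1.le⟩ hY0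
    linarith
  have hgY : g (Y / 2) < g Y :=
    hg_mono ⟨by linarith, by linarith⟩ ⟨hY0.le, hY1.le⟩ (by linarith)
  obtain ⟨c, hc⟩ : ∃ c, c = (Y / 2) * (g Y - g (Y / 2)) := ⟨_, rfl⟩
  have hc0 : 0 < c := by rw [hc]; exact mul_pos (by linarith) (by linarith)
  obtain ⟨V, hV⟩ : ∃ V, V = ∫ θ in (0 : ℝ)..1, g θ := ⟨_, rfl⟩
  have hV0 : 0 ≤ V := by
    have := aux_lower g hg_cont hg_mono le_rfl zero_le_one le_rfl
    rw [hg0] at this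
    linarith
  obtain ⟨ε, hε⟩ : ∃ ε, ε = c * f Y / (M * V + 1) := ⟨_, rfl⟩
  have hMV : 0 ≤ M * V := mul_nonneg hM.le hV0
  have hε0 : 0 < ε := by rw [hε]; positivity
  have hε1 : M * V * ε ≤ c * f Y := by
    have : (M * V + 1) * ε = c * f Y := by rw [hε]; field_simp
    linarith
  obtain ⟨B, hB⟩ : ∃ B, B = max Y (1 - ε) := ⟨_, rfl⟩
  have hB1 : B < 1 := by rw [hB]; exact max_lt hY1 (by linarith)
  have hBY : Y ≤ B := by rw [hB]; exact le_max_left _ _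
  have hBε : 1 - ε ≤ B := by rw [hB]; exact le_max_right _ _
  obtain ⟨P, hP⟩ : ∃ P, P = (1 + B) / 2 := ⟨_, rfl⟩
  have hPB : B < P := by linarith
  have hP1 : P < 1 := by linarith
  obtain ⟨e, he⟩ : ∃ e, e = (f P - f B) * (1 - P) := ⟨_, rfl⟩
  have he0 : 0 < e := by
    have : f B < f P := hf_mono ⟨by linarith, by linarith⟩ ⟨by linarith, by linarith⟩ hPB
    rw [he]; exact mul_pos (by linarith) (by linarith)
  have hq : 0 < e / (2 * f 1) := by positivity
  refine ⟨max 0 (1 - e / (2 * f 1)), ⟨le_max_left _ _, max_lt one_pos (by linarith)⟩, ?_⟩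
  intro δ ⟨hδD, hδ1⟩ β ⟨hβ0, hβ1⟩ hβ
  have hδ0 : 0 ≤ δ := (le_max_left _ _).trans hδD
  have hδe : 1 - e / (2 * f 1) ≤ δ := (le_max_right _ _).trans hδD
  have hGβ := hG β
  obtain ⟨F, hF⟩ : ∃ F, F = ∫ θ in β..1, f θ := ⟨_, rfl⟩
  have hFl := aux_lower f hf_cont hf_mono hβ0.le hβ1 le_rfl
  have hFu := aux_upper f hf_cont hf_mono hβ0.le hβ1 le_rfl
  rw [← hF] at hGβ hFl hFu
  have hN : G β * (1 - δ) = F - (1 - β) * f β := by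
    have : G β * (1 - δ) = G β - f β := by rw [hβ]; ring
    rw [this, hGβ]; ring
  have hf1β : f β ≤ f 1 := hf_mono.monotoneOn ⟨hβ0.le, hβ1⟩ ⟨zero_le_one, le_rfl⟩ hβ1
  rcases lt_or_ge β B with hlt | hge
  · exfalso
    have h1 := aux_lower f hf_cont hf_mono (a := β) (b := P) hβ0.le (by linarith) hP1.le
    have h2 := aux_lower f hf_cont hf_mono (a := P) (b := 1) (by linarith) hP1.le le_rfl
    have h3 := aux_add f hf_cont hβ0.le (hlt.trans hPB).le hP1.le le_rfl
    rw [← hF] at h3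
    have hfB : f β ≤ f B :=
      hf_mono.monotoneOn ⟨hβ0.le, hβ1⟩ ⟨by linarith, by linarith⟩ hlt.le
    have h4 : (f P - f B) * (1 - P) ≤ (f P - f β) * (1 - P) :=
      mul_le_mul_of_nonneg_right (by linarith) (by linarith)
    have h5 : e ≤ G β * (1 - δ) := by
      rw [hN, he]; nlinarith
    have hG1 : G β ≤ f 1 := by
      rw [hGβ]
      have := mul_le_mul_of_nonneg_left hf1β hβ0.le
      linarith
    have h6 : G β * (1 - δ) ≤ f 1 * (e / (2 * f 1)) :=
      (mul_le_mul_of_nonneg_right hG1 (by linarith)).trans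
        (mul_le_mul_of_nonneg_left (by linarith) hf1.le)
    have h7 : f 1 * (e / (2 * f 1)) = e / 2 := by field_simp
    linarith
  · have hYβ : Y ≤ β := hBY.trans hge
    have hs : 0 ≤ 1 - β := by linarith
    have hfYβ : f Y ≤ f β := hf_mono.monotoneOn ⟨hY0.le, hY1.le⟩ ⟨hβ0.le, hβ1⟩ hYβ
    have hgYβ : g Y ≤ g β := hg_mono.monotoneOn ⟨hY0.le, hY1.le⟩ ⟨hβ0.le, hβ1⟩ hYβ
    have hGf : f Y ≤ G β := by rw [hGβ]; linarith
    have k1 : f Y * (1 - δ) ≤ M * (1 - β) * (1 - β) := by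
      have a1 := mul_le_mul_of_nonneg_right hGf (sub_nonneg.2 hδ1)
      have a2 := mul_le_mul_of_nonneg_right (hL β ⟨hYβ, hβ1⟩) hs
      linarith
    have k2 : (1 - δ) * V ≤ (1 - β) * c := by
      have a1 := mul_le_mul_of_nonneg_right k1 hV0
      have a2 : M * V * (1 - β) ≤ c * f Y :=
        (mul_le_mul_of_nonneg_left (by linarith) hMV).trans hε1
      have a3 := mul_le_mul_of_nonneg_right a2 hs
      refine le_of_mul_le_mul_left ?_ hfY
      linarith
    have g1 := aux_upper g hg_cont hg_mono (a := 0) (b := Y / 2) le_rfl (by linarith) (by linarith)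
    have g2 := aux_upper g hg_cont hg_mono (a := Y / 2) (b := β) (by linarith) (by linarith) hβ1
    have g3 := aux_add g hg_cont (a := 0) (b := Y / 2) (c := β) le_rfl (by linarith)
      (by linarith) hβ1
    have g4 := aux_lower g hg_cont hg_mono hβ0.le hβ1 le_rfl
    have g5 := aux_add g hg_cont le_rfl hβ0.le hβ1 le_rfl
    rw [← hV] at g5 ⊢
    obtain ⟨I, hI⟩ : ∃ I, I = ∫ θ in (0 : ℝ)..β, g θ := ⟨_, rfl⟩
    rw [← hI] at g3 g5 ⊢
    have k3 : c ≤ β * g β - I := by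
      have := mul_le_mul_of_nonneg_left hgYβ (by linarith : 0 ≤ Y / 2)
      rw [hc]; linarith
    have k4 := mul_le_mul_of_nonneg_left k3 hs
    have k5 : β * (I + g β * (1 - β)) ≤ β * V :=
      mul_le_mul_of_nonneg_left (by linarith) hβ0.le
    have k6 : β * ((1 - δ) * V) ≤ (1 - δ) * V :=
      mul_le_of_le_one_left (mul_nonneg (by linarith) hV0) hβ1
    rw [ge_iff_le, one_div_mul_eq_div, div_le_iff₀ hβ0]
    linarith
end

section
/- Let δ ∈ (0,1) and let a : ℕ → [0,1] satisfy f(a(n)) = δ·G(a(n+1)) for all n ∈ ℕ. Then a(n) = β for every n, where β is the unique solution in [0,1] of f(β) = δ·G(β). (Consequently the unique regular strategy profile of the infinite-horizon game is stationary with threshold β.) -/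
theorem G_lip_aux (f : ℝ → ℝ)
    (hf_cont : ContinuousOn f (Set.Icc 0 1))
    (hf_mono : StrictMonoOn f (Set.Icc 0 1))
    (G : ℝ → ℝ)
    (hG : ∀ x, G x = x * f x + ∫ θ in x..1, f θ)
    (x y : ℝ) (hx : x ∈ Set.Icc (0 : ℝ) 1) (hy : y ∈ Set.Icc (0 : ℝ) 1) (hxy : x ≤ y) :
    |G y - G x| ≤ f y - f x := by
  have hint : ∀ u v : ℝ, u ∈ Set.Icc (0 : ℝ) 1 → v ∈ Set.Icc (0 : ℝ) 1 →
      IntervalIntegrable f MeasureTheory.volume u v := fun u v hu hv =>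
    (hf_cont.mono (Set.uIcc_subset_Icc hu hv)).intervalIntegrable
  have h1 : (1 : ℝ) ∈ Set.Icc (0 : ℝ) 1 := by simp
  have hsplit := intervalIntegral.integral_add_adjacent_intervals (hint x y hx hy) (hint y 1 hy h1)
  have hf : f x ≤ f y := hf_mono.monotoneOn hx hy hxy
  have hmem : ∀ t ∈ Set.Icc x y, t ∈ Set.Icc (0 : ℝ) 1 := fun t ht =>
    ⟨hx.1.trans ht.1, ht.2.trans hy.2⟩
  have hlo : ∫ _ in x..y, f x ≤ ∫ t in x..y, f t :=
    intervalIntegral.integral_mono_on hxy (by simp) (hint x y hx hy)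
      (fun t ht => hf_mono.monotoneOn hx (hmem t ht) ht.1)
  have hhi : ∫ t in x..y, f t ≤ ∫ _ in x..y, f y :=
    intervalIntegral.integral_mono_on hxy (hint x y hx hy) (by simp)
      (fun t ht => hf_mono.monotoneOn (hmem t ht) hy ht.2)
  simp only [intervalIntegral.integral_const, smul_eq_mul] at hlo hhi
  obtain ⟨hx0, hx1⟩ := hx
  obtain ⟨hy0, hy1⟩ := hy
  rw [hG, hG, abs_le]
  constructor
  · nlinarith [mul_nonneg hx0 (sub_nonneg.2 hf)]
  · nlinarith [mul_nonneg (sub_nonneg.2 hy1) (sub_nonneg.2 hf)]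

/-- Let `f` be continuous and strictly increasing on `[0,1]` with `f 0 = 0`, and let
`G x = x * f x + ∫ θ in x..1, f θ`.  Let `δ ∈ (0,1)` and let `a : ℕ → [0,1]` satisfy
`f (a n) = δ * G (a (n+1))` for all `n` (the recursion satisfied by the thresholds of a
regular strategy profile of the infinite-horizon game).  Then `a n = β` for every `n`,
where `β` is the unique solution in `[0,1]` of `f β = δ * G β`.  (Consequently the unique
regular strategy profile is stationary with threshold `β`.) -/
theorem regular_profile_stationary
    (f : ℝ → ℝ)
    (hf_cont : ContinuousOn f (Set.Icc 0 1))
    (hf_mono : StrictMonoOn f (Set.Icc 0 1))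
    (hf0 : f 0 = 0)
    (δ : ℝ) (hδ : δ ∈ Set.Ioo (0 : ℝ) 1)
    (G : ℝ → ℝ)
    (hG : ∀ x, G x = x * f x + ∫ θ in x..1, f θ)
    (a : ℕ → ℝ)
    (ha_mem : ∀ n, a n ∈ Set.Icc (0 : ℝ) 1)
    (hrec : ∀ n, f (a n) = δ * G (a (n + 1)))
    (β : ℝ) (hβ : β ∈ Set.Icc (0 : ℝ) 1) (hfix : f β = δ * G β) :
    ∀ n, a n = β := by
  have hlip : ∀ x ∈ Set.Icc (0 : ℝ) 1, |G x - G β| ≤ |f x - f β| := by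
    intro x hx
    rcases le_total x β with h | h
    · rw [abs_sub_comm, abs_sub_comm (f x)]
      exact (G_lip_aux f hf_cont hf_mono G hG x β hx hβ h).trans (le_abs_self _)
    · exact (G_lip_aux f hf_cont hf_mono G hG β x hβ hx h).trans (le_abs_self _)
  have hb : ∀ x ∈ Set.Icc (0 : ℝ) 1, 0 ≤ f x ∧ f x ≤ f 1 := fun x hx =>
    ⟨hf0 ▸ hf_mono.monotoneOn (by simp) hx hx.1, hf_mono.monotoneOn hx (by simp) hx.2⟩
  have key : ∀ k n, |f (a n) - f β| ≤ δ ^ k * f 1 := by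
    intro k
    induction k with
    | zero =>
      intro n
      have h1 := hb _ (ha_mem n)
      have h2 := hb _ hβ
      rw [abs_le]
      constructor <;> simp <;> linarith
    | succ k ih =>
      intro n
      rw [hrec n, hfix, ← mul_sub, abs_mul, abs_of_pos hδ.1, pow_succ', mul_assoc]
      exact mul_le_mul_of_nonneg_left ((hlip _ (ha_mem _)).trans (ih _)) hδ.1.le
  intro n
  have hlim : Filter.Tendsto (fun k : ℕ => δ ^ k * f 1) Filter.atTop (nhds 0) := by
    simpa using (tendsto_pow_atTop_nhds_zero_of_lt_one hδ.1.le hδ.2).mul_const (f 1)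
  have h0 : |f (a n) - f β| ≤ 0 := ge_of_tendsto' hlim (fun k => key k n)
  exact hf_mono.injOn (ha_mem n) hβ (sub_eq_zero.1 (abs_nonpos_iff.1 h0))
end

section
/- Let δ ∈ (0,1) and let a : ℕ → [0,1] satisfy f(a(n)) ≤ δ·G(a(n+1)) for all n ∈ ℕ. Then a(n) ≤ β for every n, where β is the unique solution in [0,1] of f(β) = δ·G(β). -/
/-- Let `f` be continuous and strictly increasing on `[0,1]` with `f 0 = 0`, and let
`G x = x * f x + ∫ θ in x..1, f θ`.  Let `δ ∈ (0,1)` and let `a : ℕ → [0,1]` satisfy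
`f (a n) ≤ δ * G (a (n+1))` for all `n`.  Then `a n ≤ β` for every `n`, where `β` is the
unique solution in `[0,1]` of `f β = δ * G β`. -/
theorem thresholds_below_beta
    (f : ℝ → ℝ)
    (hf_cont : ContinuousOn f (Set.Icc 0 1))
    (hf_mono : StrictMonoOn f (Set.Icc 0 1))
    (hf0 : f 0 = 0)
    (δ : ℝ) (hδ : δ ∈ Set.Ioo (0 : ℝ) 1)
    (G : ℝ → ℝ)
    (hG : ∀ x, G x = x * f x + ∫ θ in x..1, f θ)
    (a : ℕ → ℝ)
    (ha_mem : ∀ n, a n ∈ Set.Icc (0 : ℝ) 1)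
    (hrec : ∀ n, f (a n) ≤ δ * G (a (n + 1)))
    (β : ℝ) (hβ : β ∈ Set.Icc (0 : ℝ) 1) (hfix : f β = δ * G β) :
    ∀ n, a n ≤ β := by
  obtain ⟨hδ0, hδ1⟩ := hδ
  have hmono := hf_mono.monotoneOn
  have hint : ∀ x ∈ Set.Icc (0:ℝ) 1, ∀ y ∈ Set.Icc (0:ℝ) 1,
      IntervalIntegrable f MeasureTheory.volume x y := by
    intro x hx y hy
    exact (hf_cont.mono (Set.uIcc_subset_Icc hx hy)).intervalIntegrable
  have h1 : (1:ℝ) ∈ Set.Icc (0:ℝ) 1 := by norm_num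
  have h0 : (0:ℝ) ∈ Set.Icc (0:ℝ) 1 := by norm_num
  have key : ∀ y ∈ Set.Icc (0:ℝ) 1, ∀ x ∈ Set.Icc (0:ℝ) 1, y ≤ x →
      y * (f x - f y) ≤ G x - G y ∧ G x - G y ≤ x * (f x - f y) := by
    intro y hy x hx hyx
    have hadd := intervalIntegral.integral_add_adjacent_intervals
      (hint y hy x hx) (hint x hx 1 h1)
    have hup : ∫ θ in y..x, f θ ≤ ∫ θ in y..x, f x := by
      apply intervalIntegral.integral_mono_on hyx (hint y hy x hx) (by simp)
      intro t ht
      exact hmono ⟨hy.1.trans ht.1, ht.2.trans hx.2⟩ hx ht.2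
    have hlo : ∫ θ in y..x, f y ≤ ∫ θ in y..x, f θ := by
      apply intervalIntegral.integral_mono_on hyx (by simp) (hint y hy x hx)
      intro t ht
      exact hmono hy ⟨hy.1.trans ht.1, ht.2.trans hx.2⟩ ht.1
    simp only [intervalIntegral.integral_const, smul_eq_mul] at hup hlo
    rw [hG x, hG y]
    constructor <;> linarith
  have hf1 : 0 ≤ f 1 := hf0 ▸ hmono h0 h1 zero_le_one
  have hfβ : 0 ≤ f β := hf0 ▸ hmono h0 hβ hβ.1
  have hbound : ∀ k : ℕ, ∀ n, f (a n) - f β ≤ δ ^ k * f 1 := by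
    intro k
    induction k with
    | zero =>
      intro n
      have := hmono (ha_mem n) h1 (ha_mem n).2
      simp
      linarith
    | succ k ih =>
      intro n
      have hk : 0 ≤ δ ^ k * f 1 := by positivity
      have hx := ha_mem (n + 1)
      have hstep : G (a (n + 1)) - G β ≤ δ ^ k * f 1 := by
        rcases le_total β (a (n + 1)) with h | h
        · have h2 := (key β hβ _ hx h).2
          have h3 := hmono hβ hx h
          have h4 := ih (n + 1)
          nlinarith [hx.2]
        · have h2 := (key _ hx β hβ h).1
          have h3 := mul_nonneg hx.1 (sub_nonneg.2 (hmono hx hβ h))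
          linarith
      have h5 := mul_le_mul_of_nonneg_left hstep hδ0.le
      have h6 := hrec n
      rw [pow_succ]
      linarith
  intro n
  have hlim : Filter.Tendsto (fun k : ℕ => δ ^ k * f 1) Filter.atTop (nhds (0 * f 1)) :=
    (tendsto_pow_atTop_nhds_zero_of_lt_one hδ0.le hδ1).mul_const _
  have hle : f (a n) - f β ≤ 0 * f 1 := ge_of_tendsto' hlim (fun k => hbound k n)
  exact (hf_mono.le_iff_le (ha_mem n) hβ).1 (by linarith)
end
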